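/- Let L = (ℕ × ℕ) ∪ {⊤} ordered by (m,n) ≤ (s,t) iff m = s and n ≤ t, and x ≤ ⊤ for all x. Then L is a dcpo that has weak one-step closure but is not quasicontinuous. -/

import Mathlib

open Set

section OrderDefs

variable {L : Type*} [Preorder L]

/-- Downward closure `↓A`. -/
def dw (A : Set L) : Set L := {x | ∃ a ∈ A, x ≤ a}

/-- Upward closure `↑A`. -/
def up (A : Set L) : Set L := {x | ∃ a ∈ A, a ≤ x}

/-- Scott closure of a set. -/
def scottCl (A : Set L) : Set L := @closure L (Topology.scott L Set.univ) A

/-- `A' = {x : ∃ directed D ⊆ ↓A with x = sup D}`. -/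
def oneStep (A : Set L) : Set L :=
  {x | ∃ D : Set L, D ⊆ dw A ∧ D.Nonempty ∧ DirectedOn (· ≤ ·) D ∧ IsLUB D x}

/-- `A'' = {x : ∃ directed D ⊆ ↓A with x ≤ sup D}`. -/
def weakOneStep (A : Set L) : Set L :=
  {x | ∃ D : Set L, D ⊆ dw A ∧ D.Nonempty ∧ DirectedOn (· ≤ ·) D ∧ ∃ y, IsLUB D y ∧ x ≤ y}

/-- A poset has one-step closure if `cl(A) = A'` for all `A`. -/
def HasOneStepClosure (L : Type*) [Preorder L] : Prop :=
  ∀ A : Set L, scottCl A = oneStep A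

/-- A poset has weak one-step closure if `cl(A) = A''` for all `A`. -/
def HasWeakOneStepClosure (L : Type*) [Preorder L] : Prop :=
  ∀ A : Set L, scottCl A = weakOneStep A

/-- Meet continuity: `x ≤ sup D` implies `x ∈ cl(↓D ∩ ↓x)`. -/
def MeetContinuous (L : Type*) [Preorder L] : Prop :=
  ∀ x : L, ∀ D : Set L, D.Nonempty → DirectedOn (· ≤ ·) D → ∀ s, IsLUB D s → x ≤ s →
    x ∈ scottCl (dw D ∩ dw ({x} : Set L))

/-- The way-below relation `x ≪ y`. -/
def wayBelow (x y : L) : Prop :=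
  ∀ D : Set L, D.Nonempty → DirectedOn (· ≤ ·) D → ∀ s, IsLUB D s → y ≤ s →
    (D ∩ up ({x} : Set L)).Nonempty

/-- The weakly way-below relation `x ≪_w y`. -/
def weaklyWayBelow (x y : L) : Prop :=
  ∀ D : Set L, D.Nonempty → DirectedOn (· ≤ ·) D → IsLUB D y →
    (D ∩ up ({x} : Set L)).Nonempty

/-- A continuous poset: each `⇓x` is directed with supremum `x`. -/
def ContinuousPoset (L : Type*) [Preorder L] : Prop :=
  ∀ x : L, {y | wayBelow y x}.Nonempty ∧ DirectedOn (· ≤ ·) {y | wayBelow y x} ∧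
    IsLUB {y | wayBelow y x} x

/-- An exact poset: each `⇓_w x` is directed with supremum `x`. -/
def ExactPoset (L : Type*) [Preorder L] : Prop :=
  ∀ x : L, {y | weaklyWayBelow y x}.Nonempty ∧ DirectedOn (· ≤ ·) {y | weaklyWayBelow y x} ∧
    IsLUB {y | weaklyWayBelow y x} x

/-- `F ≪ x` for a set `F`: every directed `D` with `sup D ≥ x` meets `↑F`. -/
def finWayBelow (F : Set L) (x : L) : Prop :=
  ∀ D : Set L, D.Nonempty → DirectedOn (· ≤ ·) D → ∀ s, IsLUB D s → x ≤ s →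
    (D ∩ up F).Nonempty

/-- A quasicontinuous poset: each `fin(x)` is a directed family (Smyth preorder)
with `↑x = ⋂_{F ∈ fin(x)} ↑F`. -/
def QuasicontinuousPoset (L : Type*) [Preorder L] : Prop :=
  ∀ x : L, {F : Set L | F.Finite ∧ finWayBelow F x}.Nonempty ∧
    DirectedOn (fun F G => up G ⊆ up F) {F : Set L | F.Finite ∧ finWayBelow F x} ∧
    up ({x} : Set L) = ⋂ F ∈ {F : Set L | F.Finite ∧ finWayBelow F x}, up F

/-- A dcpo: every (nonempty) directed subset has a least upper bound. -/
def IsDcpo (L : Type*) [Preorder L] : Prop :=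
  ∀ D : Set L, D.Nonempty → DirectedOn (· ≤ ·) D → ∃ x, IsLUB D x

end OrderDefs

/-- `L = (ℕ × ℕ) ∪ {⊤}` with `(m,n) ≤ (s,t)` iff `m = s` and `n ≤ t`, and `x ≤ ⊤` for all
`x`. This is exactly `WithTop (Σ _ : ℕ, ℕ)` with the disjoint-union (sigma) order. -/
abbrev L₁ : Type := WithTop (Σ _ : ℕ, ℕ)

theorem L₁_le_coe {x : L₁} {m n : ℕ} (h : x ≤ ((⟨m, n⟩ : Σ _ : ℕ, ℕ) : L₁)) :
    ∃ k ≤ n, x = ((⟨m, k⟩ : Σ _ : ℕ, ℕ) : L₁) := by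
  induction x using WithTop.recTopCoe with
  | top => exact absurd (top_le_iff.1 h) (WithTop.coe_ne_top)
  | coe a =>
    obtain ⟨i, j⟩ := a
    have h' := WithTop.coe_le_coe.1 h
    cases h' with
    | fiber _ _ _ hab => exact ⟨j, hab, rfl⟩

theorem L₁_exists_greatest {D : Set L₁} (hne : D.Nonempty) (hD : DirectedOn (· ≤ ·) D)
    (p : Σ _ : ℕ, ℕ) (hp : (p : L₁) ∈ upperBounds D) : ∃ g, IsGreatest D g := by
  obtain ⟨m, n⟩ := p
  have hfin : D.Finite := by
    refine ((Set.finite_Iic n).image (fun k => ((⟨m, k⟩ : Σ _ : ℕ, ℕ) : L₁))).subset ?_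
    intro x hx
    obtain ⟨k, hk, rfl⟩ := L₁_le_coe (hp hx)
    exact ⟨k, hk, rfl⟩
  obtain ⟨g, hg⟩ := hfin.exists_maximal hne
  refine ⟨g, hg.1, fun x hx => ?_⟩
  obtain ⟨z, hz, hgz, hxz⟩ := hD g hg.1 x hx
  exact hxz.trans (hg.2 hz hgz)

theorem L₁_lub {D : Set L₁} (hne : D.Nonempty) (hD : DirectedOn (· ≤ ·) D)
    {s : L₁} (hs : IsLUB D s) : s ∈ D ∨ s = ⊤ := by
  induction s using WithTop.recTopCoe with
  | top => exact Or.inr rfl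
  | coe p =>
    obtain ⟨g, hg⟩ := L₁_exists_greatest hne hD p hs.1
    left
    rw [hs.unique hg.isLUB]
    exact hg.1

theorem L₁_dcpo : IsDcpo L₁ := by
  intro D hne hD
  by_cases h : ∃ p : Σ _ : ℕ, ℕ, (p : L₁) ∈ upperBounds D
  · obtain ⟨p, hp⟩ := h
    obtain ⟨g, hg⟩ := L₁_exists_greatest hne hD p hp
    exact ⟨g, hg.isLUB⟩
  · refine ⟨⊤, fun _ _ => le_top, fun y hy => ?_⟩
    induction y using WithTop.recTopCoe with
    | top => exact le_rfl
    | coe p => exact absurd ⟨p, hy⟩ h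

theorem L₁_weak : HasWeakOneStepClosure L₁ := by
  intro A
  let _ : TopologicalSpace L₁ := Topology.scott L₁ Set.univ
  have : Topology.IsScott L₁ Set.univ := ⟨rfl⟩
  change closure A = _
  apply Set.Subset.antisymm
  · apply closure_minimal
    · intro a ha
      refine ⟨{a}, ?_, singleton_nonempty a, directedOn_singleton _, a, isLUB_singleton, le_rfl⟩
      rintro _ rfl
      exact ⟨_, ha, le_rfl⟩
    · rw [Topology.IsScott.isClosed_iff_isLowerSet_and_dirSupClosed]
      constructor
      · rintro a b hba ⟨D, h1, h2, h3, y, h4, h5⟩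
        exact ⟨D, h1, h2, h3, y, h4, hba.trans h5⟩
      · intro D hDA hne hD s hs
        by_cases ht : (⊤ : L₁) ∈ weakOneStep A
        · obtain ⟨E, h1, h2, h3, y, h4, h5⟩ := ht
          exact ⟨E, h1, h2, h3, y, h4, le_top.trans h5⟩
        · refine ⟨D, ?_, hne, hD, s, hs, le_rfl⟩
          intro x hx
          obtain ⟨E, h1, h2, h3, y, h4, h5⟩ := hDA hx
          rcases L₁_lub h2 h3 h4 with h | h
          · obtain ⟨a, ha, hya⟩ := h1 h
            exact ⟨a, ha, h5.trans hya⟩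
          · exact absurd ⟨E, h1, h2, h3, y, h4, h.ge⟩ ht
  · rintro x ⟨D, h1, h2, h3, y, h4, h5⟩
    have hc : IsClosed (closure A) := isClosed_closure
    rw [Topology.IsScott.isClosed_iff_isLowerSet_and_dirSupClosed] at hc
    refine hc.1 h5 (hc.2 ?_ h2 h3 h4)
    intro d hd
    obtain ⟨a, ha, hda⟩ := h1 hd
    exact hc.1 hda (subset_closure ha)

theorem L₁_not_quasi : ¬ QuasicontinuousPoset L₁ := by
  intro h
  obtain ⟨⟨F, hF, hw⟩, -⟩ := h ⊤
  let e : ℕ → ℕ → L₁ := fun m k => ((⟨m, k⟩ : Σ _ : ℕ, ℕ) : L₁)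
  have hmono : ∀ m, Monotone (e m) := fun m i j hij =>
    WithTop.coe_le_coe.2 (Sigma.mk_le_mk_iff.2 hij)
  let f : L₁ → ℕ := fun x => WithTop.recTopCoe (C := fun _ => ℕ) 0 (fun p => p.1) x
  obtain ⟨m, hm⟩ := (hF.image f).exists_notMem
  have hlub : IsLUB (Set.range (e m)) ⊤ := by
    refine ⟨fun _ _ => le_top, fun y hy => ?_⟩
    induction y using WithTop.recTopCoe with
    | top => exact le_rfl
    | coe p =>
      obtain ⟨i, j⟩ := p
      obtain ⟨k, hk, hek⟩ := L₁_le_coe (hy ⟨j + 1, rfl⟩)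
      have h2 := WithTop.coe_injective hek
      simp only [Sigma.mk.injEq, heq_eq_eq] at h2
      omega
  obtain ⟨_, ⟨k, rfl⟩, a, ha, hak⟩ := hw (Set.range (e m)) (Set.range_nonempty _)
    (directedOn_range.2 (hmono m).directed_le) ⊤ hlub le_top
  obtain ⟨j, -, rfl⟩ := L₁_le_coe hak
  exact hm ⟨_, ha, rfl⟩

/-- `L₁` is a dcpo with weak one-step closure which is not quasicontinuous. -/
theorem L₁_dcpo_weakOneStep_not_quasicontinuous :
    IsDcpo L₁ ∧ HasWeakOneStepClosure L₁ ∧ ¬ QuasicontinuousPoset L₁ := by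
  exact ⟨L₁_dcpo, L₁_weak, L₁_not_quasi⟩
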